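/- Fix n ≥ 1 and let H, I, U, V : ℝ → Matrix (Fin n) (Fin n) ℂ be such that for every t ∈ ℝ: U has derivative −i·H(t)·U(t) at t, V has derivative i·V(t)·H(t) at t, I has derivative −i·(H(t)·I(t) − I(t)·H(t)) at t, U(0) = V(0) = 1, and V(t)·U(t) = 1 = U(t)·V(t) for all t. If ψ : Fin n → ℂ and λ ∈ ℂ satisfy I(0) ·ᵥ ψ = λ • ψ, then for every t ∈ ℝ, I(t) ·ᵥ (U(t) ·ᵥ ψ) = λ • (U(t) ·ᵥ ψ). -/

import Mathlib

open Matrix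

/-- Entrywise derivative of a matrix-valued function of a real variable. -/
def MatrixHasDerivAt {n : ℕ} (F : ℝ → Matrix (Fin n) (Fin n) ℂ)
    (F' : Matrix (Fin n) (Fin n) ℂ) (t : ℝ) : Prop :=
  ∀ i j, HasDerivAt (fun s => F s i j) (F' i j) t

theorem MatrixHasDerivAt.mul_aux {n : ℕ} {F G : ℝ → Matrix (Fin n) (Fin n) ℂ}
    {F' G' : Matrix (Fin n) (Fin n) ℂ} {t : ℝ}
    (hF : MatrixHasDerivAt F F' t) (hG : MatrixHasDerivAt G G' t) :
    MatrixHasDerivAt (fun s => F s * G s) (F' * G t + F t * G') t := by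
  intro i j
  simp only [Matrix.mul_apply, Matrix.add_apply, ← Finset.sum_add_distrib]
  exact HasDerivAt.fun_sum fun k _ => (hF i k).mul (hG k j)

/-- **Transport of eigenstates of a dynamical invariant.**
If `ψ` is an eigenvector of `Iv(0)` with eigenvalue `λ`, then `U(t)ψ` is an eigenvector
of `Iv(t)` with the same eigenvalue `λ`, for all `t`. -/
theorem invariant_eigenvector_transport
    (n : ℕ) (hn : 1 ≤ n)
    (H Iv U V : ℝ → Matrix (Fin n) (Fin n) ℂ)
    (hU : ∀ t : ℝ, MatrixHasDerivAt U ((-Complex.I) • (H t * U t)) t)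
    (hV : ∀ t : ℝ, MatrixHasDerivAt V (Complex.I • (V t * H t)) t)
    (hI : ∀ t : ℝ, MatrixHasDerivAt Iv ((-Complex.I) • (H t * Iv t - Iv t * H t)) t)
    (hU0 : U 0 = 1) (hV0 : V 0 = 1)
    (hVU : ∀ t : ℝ, V t * U t = 1) (hUV : ∀ t : ℝ, U t * V t = 1)
    (ψ : Fin n → ℂ) (lam : ℂ) (hψ : Iv 0 *ᵥ ψ = lam • ψ) :
    ∀ t : ℝ, Iv t *ᵥ (U t *ᵥ ψ) = lam • (U t *ᵥ ψ) := by
  have hd : ∀ t : ℝ, MatrixHasDerivAt (fun s => V s * Iv s * U s) 0 t := by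
    intro t
    have h := ((hV t).mul_aux (hI t)).mul_aux (hU t)
    convert h using 1
    simp only [Matrix.mul_sub, Matrix.sub_mul, Matrix.add_mul, Matrix.smul_mul, Matrix.mul_smul,
      Matrix.mul_assoc, smul_sub, neg_smul, Matrix.neg_mul, Matrix.mul_neg]
    abel
  have hc : ∀ t : ℝ, V t * Iv t * U t = Iv 0 := by
    intro t
    have h0 : V 0 * Iv 0 * U 0 = Iv 0 := by rw [hU0, hV0, one_mul, mul_one]
    rw [← h0]
    ext i j
    exact is_const_of_deriv_eq_zero (f := fun s => (V s * Iv s * U s) i j)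
      (fun s => (hd s i j).differentiableAt) (fun s => (hd s i j).deriv) t 0
  intro t
  have h1 : Iv t * U t = U t * Iv 0 := by
    rw [← hc t, Matrix.mul_assoc (V t), ← Matrix.mul_assoc (U t), hUV, one_mul]
  rw [Matrix.mulVec_mulVec, h1, ← Matrix.mulVec_mulVec, hψ, Matrix.mulVec_smul]
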